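/- arXiv:1611.09035 — 11 statements merged into one kernel-verified Lean document; each statement's English description precedes it below -/
import Mathlib

section
/- (Strong normalization of the BATC term rewriting system.) The term rewriting system of BATC is strongly normalizing: there is no infinite sequence t0 → t1 → t2 → ⋯ of one-step rewrites of BATC terms. -/
/-- BATC terms over a type `E` of atomic events: `t ::= e | t·t | t+t`. -/
inductive BATC (E : Type) : Type
  | atom : E → BATC E
  | seq : BATC E → BATC E → BATC E
  | alt : BATC E → BATC E → BATC E

namespace BATC

variable {E : Type}

/-- One-step rewriting of the BATC term rewriting system (rules RA3, RA4, RA5,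
applied to an arbitrary subterm). -/
inductive Rw : BATC E → BATC E → Prop
  | ra3 (x : BATC E) : Rw (alt x x) x
  | ra4 (x y z : BATC E) : Rw (seq (alt x y) z) (alt (seq x z) (seq y z))
  | ra5 (x y z : BATC E) : Rw (seq (seq x y) z) (seq x (seq y z))
  | seqL {x x' : BATC E} (y : BATC E) : Rw x x' → Rw (seq x y) (seq x' y)
  | seqR (x : BATC E) {y y' : BATC E} : Rw y y' → Rw (seq x y) (seq x y')
  | altL {x x' : BATC E} (y : BATC E) : Rw x x' → Rw (alt x y) (alt x' y)
  | altR (x : BATC E) {y y' : BATC E} : Rw y y' → Rw (alt x y) (alt x y')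

/-- A BATC term is a normal form if no rewrite rule applies to any of its subterms. -/
def NormalForm (t : BATC E) : Prop := ∀ t' : BATC E, ¬ Rw t t'

/-- Basic BATC terms. -/
inductive Basic : BATC E → Prop
  | atom (e : E) : Basic (atom e)
  | seqAtom (e : E) {t : BATC E} : Basic t → Basic (seq (atom e) t)
  | alt {s t : BATC E} : Basic s → Basic t → Basic (alt s t)

/-- BATC-derivable equality: the least congruence containing axioms A1–A5. -/
inductive DerEq : BATC E → BATC E → Prop
  | refl (x : BATC E) : DerEq x x
  | symm {x y : BATC E} : DerEq x y → DerEq y x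
  | trans {x y z : BATC E} : DerEq x y → DerEq y z → DerEq x z
  | seq_congr {x x' y y' : BATC E} : DerEq x x' → DerEq y y' → DerEq (seq x y) (seq x' y')
  | alt_congr {x x' y y' : BATC E} : DerEq x x' → DerEq y y' → DerEq (alt x y) (alt x' y')
  | A1 (x y : BATC E) : DerEq (alt x y) (alt y x)
  | A2 (x y z : BATC E) : DerEq (alt (alt x y) z) (alt x (alt y z))
  | A3 (x : BATC E) : DerEq (alt x x) x
  | A4 (x y z : BATC E) : DerEq (seq (alt x y) z) (alt (seq x z) (seq y z))
  | A5 (x y z : BATC E) : DerEq (seq (seq x y) z) (seq x (seq y z))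

/-- Single-event transitions `t →e t'` (target `some t'`) and `t →e √` (target `none`). -/
inductive Tr : BATC E → E → Option (BATC E) → Prop
  | ax (e : E) : Tr (atom e) e none
  | altL {x : BATC E} {e : E} {o : Option (BATC E)} (y : BATC E) :
      Tr x e o → Tr (alt x y) e o
  | altR (x : BATC E) {y : BATC E} {e : E} {o : Option (BATC E)} :
      Tr y e o → Tr (alt x y) e o
  | seqDone {x : BATC E} {e : E} (y : BATC E) : Tr x e none → Tr (seq x y) e (some y)
  | seqStep {x x' : BATC E} {e : E} (y : BATC E) :
      Tr x e (some x') → Tr (seq x y) e (some (seq x' y))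

/-- `R` is a bisimulation. -/
def IsBisim (R : BATC E → BATC E → Prop) : Prop :=
  ∀ p q, R p q →
    (∀ e p', Tr p e (some p') → ∃ q', Tr q e (some q') ∧ R p' q') ∧
    (∀ e q', Tr q e (some q') → ∃ p', Tr p e (some p') ∧ R p' q') ∧
    (∀ e, Tr p e none → Tr q e none) ∧
    (∀ e, Tr q e none → Tr p e none)

/-- Bisimilarity `p ∼HM q`. -/
def Bisim (p q : BATC E) : Prop := ∃ R, IsBisim R ∧ R p q

end BATC

namespace BATC

/-- A polynomial interpretation of terms that strictly decreases under rewriting. -/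
def weight {E : Type} : BATC E → ℕ
  | atom _ => 1
  | seq x y => weight x * (weight y + 1)
  | alt x y => weight x + weight y + 1

theorem weight_pos {E : Type} (t : BATC E) : 0 < t.weight := by
  induction t with
  | atom e => exact Nat.one_pos
  | seq x y hx _ => exact Nat.mul_pos hx (Nat.succ_pos _)
  | alt x y _ _ => exact Nat.succ_pos _

theorem Rw.weight_lt {E : Type} {s t : BATC E} (h : Rw s t) : t.weight < s.weight := by
  induction h with
  | ra3 x => simp only [weight]; omega
  | ra4 x y z =>
    have hz := z.weight_pos
    simp only [weight]
    nlinarith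
  | ra5 x y z =>
    have hxz := Nat.mul_pos x.weight_pos z.weight_pos
    simp only [weight]
    nlinarith
  | seqL y _ ih => exact Nat.mul_lt_mul_of_pos_right ih (Nat.succ_pos _)
  | seqR x _ ih => exact Nat.mul_lt_mul_of_pos_left (Nat.succ_lt_succ ih) x.weight_pos
  | altL y _ ih => simp only [weight]; omega
  | altR x _ ih => simp only [weight]; omega

end BATC

/-- Strong normalization of the BATC term rewriting system: there is no infinite
sequence `t0 → t1 → t2 → ⋯` of one-step rewrites. -/
theorem batc_trs_strongly_normalizing (E : Type) :
    ¬ ∃ f : ℕ → BATC E, ∀ n : ℕ, BATC.Rw (f n) (f (n + 1)) := by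
  rintro ⟨f, hf⟩
  obtain ⟨n, hn⟩ := WellFounded.not_rel_apply_succ (r := (· < ·)) fun n => (f n).weight
  exact hn (hf n).weight_lt
end

section
/- (Normal forms of BATC are basic terms.) Every BATC term that is a normal form of the BATC term rewriting system is a basic BATC term. -/
/-- Every BATC term in normal form is a basic BATC term. -/
theorem batc_normal_forms_are_basic {E : Type} (t : BATC E) (h : BATC.NormalForm t) :
    BATC.Basic t := by
  induction t with
  | atom e => exact .atom e
  | seq x y _ ihy =>
    have hy : BATC.Basic y := ihy fun y' hy' => h _ (.seqR x hy')
    cases x with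
    | atom e => exact .seqAtom e hy
    | seq a b => exact absurd (.ra5 a b y) (h _)
    | alt a b => exact absurd (.ra4 a b y) (h _)
  | alt x y ihx ihy =>
    exact .alt (ihx fun x' hx' => h _ (.altL y hx')) (ihy fun y' hy' => h _ (.altR x hy'))
end

section
/- (Elimination theorem of BATC.) For every BATC term p there exists a basic BATC term q such that BATC ⊢ p = q. -/
/-- The product of two basic terms is derivably equal to a basic term. -/
theorem BATC.Basic.exists_derEq_seq {E : Type} {s t : BATC E} (hs : BATC.Basic s)
    (ht : BATC.Basic t) : ∃ q : BATC E, BATC.Basic q ∧ BATC.DerEq (BATC.seq s t) q := by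
  induction hs with
  | atom e => exact ⟨_, .seqAtom e ht, .refl _⟩
  | seqAtom e _ ih =>
    obtain ⟨q, hq, h⟩ := ih
    exact ⟨_, .seqAtom e hq, .trans (.A5 _ _ _) (.seq_congr (.refl _) h)⟩
  | alt _ _ ih₁ ih₂ =>
    obtain ⟨q₁, hq₁, h₁⟩ := ih₁
    obtain ⟨q₂, hq₂, h₂⟩ := ih₂
    exact ⟨_, .alt hq₁ hq₂, .trans (.A4 _ _ _) (.alt_congr h₁ h₂)⟩

/-- Elimination theorem of BATC: every BATC term is derivably equal to a basic term. -/
theorem batc_elimination {E : Type} (p : BATC E) :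
    ∃ q : BATC E, BATC.Basic q ∧ BATC.DerEq p q := by
  induction p with
  | atom e => exact ⟨_, .atom e, .refl _⟩
  | seq _ _ ih₁ ih₂ =>
    obtain ⟨q₁, hq₁, h₁⟩ := ih₁
    obtain ⟨q₂, hq₂, h₂⟩ := ih₂
    obtain ⟨q, hq, h⟩ := hq₁.exists_derEq_seq hq₂
    exact ⟨q, hq, .trans (.seq_congr h₁ h₂) h⟩
  | alt _ _ ih₁ ih₂ =>
    obtain ⟨q₁, hq₁, h₁⟩ := ih₁
    obtain ⟨q₂, hq₂, h₂⟩ := ih₂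
    exact ⟨_, .alt hq₁ hq₂, .alt_congr h₁ h₂⟩
end

section
/- (Congruence of BATC with respect to bisimulation equivalence.) Bisimilarity ∼HM is an equivalence relation on BATC terms and a congruence with respect to the BATC operators: if p ∼HM p' and q ∼HM q' then p+q ∼HM p'+q' and p·q ∼HM p'·q'. -/
namespace BATC

variable {E : Type}

theorem tr_alt {x y : BATC E} {e : E} {o : Option (BATC E)} :
    Tr (alt x y) e o ↔ Tr x e o ∨ Tr y e o := by
  constructor
  · intro h
    cases h with
    | altL _ h => exact .inl h
    | altR _ h => exact .inr h
  · rintro (h | h)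
    · exact .altL y h
    · exact .altR x h

theorem tr_seq_some {x y t : BATC E} {e : E} :
    Tr (seq x y) e (some t) ↔
      (Tr x e none ∧ t = y) ∨ ∃ x', Tr x e (some x') ∧ t = seq x' y := by
  constructor
  · intro h
    cases h with
    | seqDone _ h => exact .inl ⟨h, rfl⟩
    | seqStep _ h => exact .inr ⟨_, h, rfl⟩
  · rintro (⟨h, rfl⟩ | ⟨x', h, rfl⟩)
    · exact .seqDone _ h
    · exact .seqStep _ h

theorem not_tr_seq_none {x y : BATC E} {e : E} : ¬ Tr (seq x y) e none := nofun

/-- A symmetric relation satisfying the forward transfer conditions is a bisimulation. -/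
theorem IsBisim.of_symmetric {R : BATC E → BATC E → Prop} (hR : ∀ p q, R p q → R q p)
    (hstep : ∀ p q, R p q → ∀ e p', Tr p e (some p') → ∃ q', Tr q e (some q') ∧ R p' q')
    (hdone : ∀ p q, R p q → ∀ e, Tr p e none → Tr q e none) : IsBisim R := by
  refine fun p q h => ⟨hstep p q h, fun e q' hq => ?_, hdone p q h, hdone q p (hR p q h)⟩
  obtain ⟨p', hp, h'⟩ := hstep q p (hR p q h) e q' hq
  exact ⟨p', hp, hR _ _ h'⟩

namespace Bisim

theorem refl (p : BATC E) : Bisim p p :=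
  ⟨Eq, .of_symmetric (fun _ _ h => h.symm) (by rintro p _ rfl e p' h; exact ⟨p', h, rfl⟩)
    (by rintro p _ rfl e h; exact h), rfl⟩

theorem symm {p q : BATC E} : Bisim p q → Bisim q p := by
  rintro ⟨R, hR, h⟩
  refine ⟨fun a b => R b a, fun a b hab => ?_, h⟩
  obtain ⟨h₁, h₂, h₃, h₄⟩ := hR b a hab
  exact ⟨h₂, h₁, h₄, h₃⟩

theorem step {p q p' : BATC E} {e : E} : Bisim p q → Tr p e (some p') →
    ∃ q', Tr q e (some q') ∧ Bisim p' q' := by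
  rintro ⟨R, hR, h⟩ hp
  obtain ⟨q', hq, h'⟩ := (hR p q h).1 e p' hp
  exact ⟨q', hq, R, hR, h'⟩

theorem done {p q : BATC E} {e : E} : Bisim p q → Tr p e none → Tr q e none := by
  rintro ⟨R, hR, h⟩
  exact (hR p q h).2.2.1 e

theorem trans {p q r : BATC E} (hpq : Bisim p q) (hqr : Bisim q r) : Bisim p r := by
  refine ⟨fun a c => ∃ b, Bisim a b ∧ Bisim b c, .of_symmetric ?_ ?_ ?_, q, hpq, hqr⟩
  · rintro a c ⟨b, hab, hbc⟩
    exact ⟨b, hbc.symm, hab.symm⟩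
  · rintro a c ⟨b, hab, hbc⟩ e a' ha
    obtain ⟨b', hb, hab'⟩ := hab.step ha
    obtain ⟨c', hc, hbc'⟩ := hbc.step hb
    exact ⟨c', hc, b', hab', hbc'⟩
  · rintro a c ⟨b, hab, hbc⟩ e ha
    exact hbc.done (hab.done ha)

theorem alt_congr {p p' q q' : BATC E} (hp : Bisim p p') (hq : Bisim q q') :
    Bisim (alt p q) (alt p' q') := by
  refine ⟨fun a b => Bisim a b ∨ ∃ x x' y y', Bisim x x' ∧ Bisim y y' ∧
    a = alt x y ∧ b = alt x' y', .of_symmetric ?_ ?_ ?_, .inr ⟨p, p', q, q', hp, hq, rfl, rfl⟩⟩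
  · rintro a b (h | ⟨x, x', y, y', hx, hy, rfl, rfl⟩)
    · exact .inl h.symm
    · exact .inr ⟨x', x, y', y, hx.symm, hy.symm, rfl, rfl⟩
  · rintro a b (h | ⟨x, x', y, y', hx, hy, rfl, rfl⟩) e a' ha
    · obtain ⟨b', hb, h'⟩ := h.step ha
      exact ⟨b', hb, .inl h'⟩
    · rcases tr_alt.1 ha with ha | ha
      · obtain ⟨b', hb, h'⟩ := hx.step ha
        exact ⟨b', .altL _ hb, .inl h'⟩
      · obtain ⟨b', hb, h'⟩ := hy.step ha
        exact ⟨b', .altR _ hb, .inl h'⟩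
  · rintro a b (h | ⟨x, x', y, y', hx, hy, rfl, rfl⟩) e ha
    · exact h.done ha
    · exact tr_alt.2 ((tr_alt.1 ha).imp hx.done hy.done)

theorem seq_congr {p p' q q' : BATC E} (hp : Bisim p p') (hq : Bisim q q') :
    Bisim (seq p q) (seq p' q') := by
  refine ⟨fun a b => Bisim a b ∨ ∃ x x' y y', Bisim x x' ∧ Bisim y y' ∧
    a = seq x y ∧ b = seq x' y', .of_symmetric ?_ ?_ ?_, .inr ⟨p, p', q, q', hp, hq, rfl, rfl⟩⟩
  · rintro a b (h | ⟨x, x', y, y', hx, hy, rfl, rfl⟩)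
    · exact .inl h.symm
    · exact .inr ⟨x', x, y', y, hx.symm, hy.symm, rfl, rfl⟩
  · rintro a b (h | ⟨x, x', y, y', hx, hy, rfl, rfl⟩) e a' ha
    · obtain ⟨b', hb, h'⟩ := h.step ha
      exact ⟨b', hb, .inl h'⟩
    · rcases tr_seq_some.1 ha with ⟨hx₁, rfl⟩ | ⟨x₁, hx₁, rfl⟩
      · exact ⟨y', .seqDone _ (hx.done hx₁), .inl hy⟩
      · obtain ⟨x₁', hb, h'⟩ := hx.step hx₁
        exact ⟨_, .seqStep _ hb, .inr ⟨x₁, x₁', _, _, h', hy, rfl, rfl⟩⟩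
  · rintro a b (h | ⟨x, x', y, y', hx, hy, rfl, rfl⟩) e ha
    · exact h.done ha
    · exact absurd ha not_tr_seq_none

end Bisim

end BATC

/-- Bisimilarity is an equivalence relation on BATC terms and a congruence
with respect to alternative and sequential composition. -/
theorem batc_bisim_congruence (E : Type) :
    Equivalence (BATC.Bisim (E := E)) ∧
    ∀ p p' q q' : BATC E, BATC.Bisim p p' → BATC.Bisim q q' →
      BATC.Bisim (BATC.alt p q) (BATC.alt p' q') ∧
      BATC.Bisim (BATC.seq p q) (BATC.seq p' q') :=
  ⟨⟨.refl, .symm, .trans⟩, fun _ _ _ _ hp hq => ⟨.alt_congr hp hq, .seq_congr hp hq⟩⟩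
end

section
/- (Soundness of BATC modulo bisimulation equivalence.) For all BATC terms p and q, if BATC ⊢ p = q then p ∼HM q. -/
namespace BATC

theorem tr_alt_iff {E : Type} {x y : BATC E} {e : E} {o : Option (BATC E)} :
    Tr (alt x y) e o ↔ Tr x e o ∨ Tr y e o := by
  constructor
  · intro h
    cases h with
    | altL _ h => exact .inl h
    | altR _ h => exact .inr h
  · rintro (h | h)
    · exact .altL y h
    · exact .altR x h

theorem tr_seq_iff {E : Type} {x y : BATC E} {e : E} {o : Option (BATC E)} :
    Tr (seq x y) e o ↔
      (Tr x e none ∧ o = some y) ∨ ∃ x', Tr x e (some x') ∧ o = some (seq x' y) := by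
  constructor
  · intro h
    cases h with
    | seqDone _ h => exact .inl ⟨h, rfl⟩
    | seqStep _ h => exact .inr ⟨_, h, rfl⟩
  · rintro (⟨h, rfl⟩ | ⟨x', h, rfl⟩)
    · exact .seqDone y h
    · exact .seqStep y h

/-- The transfer conditions of a bisimulation at the pair `p`, `q`. -/
def Transfer {E : Type} (R : BATC E → BATC E → Prop) (p q : BATC E) : Prop :=
  (∀ e p', Tr p e (some p') → ∃ q', Tr q e (some q') ∧ R p' q') ∧
  (∀ e q', Tr q e (some q') → ∃ p', Tr p e (some p') ∧ R p' q') ∧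
  (∀ e, Tr p e none → Tr q e none) ∧
  (∀ e, Tr q e none → Tr p e none)

theorem Transfer.of_tr_iff {E : Type} {R : BATC E → BATC E → Prop} (hR : ∀ x, R x x)
    {p q : BATC E} (h : ∀ e o, Tr p e o ↔ Tr q e o) : Transfer R p q :=
  ⟨fun e p' hp => ⟨p', (h e _).1 hp, hR p'⟩, fun e q' hq => ⟨q', (h e _).2 hq, hR q'⟩,
    fun e => (h e none).1, fun e => (h e none).2⟩

theorem Transfer.symm {E : Type} {R : BATC E → BATC E → Prop} (hR : ∀ {x y}, R x y → R y x)
    {p q : BATC E} (h : Transfer R p q) : Transfer R q p := by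
  obtain ⟨h₁, h₂, h₃, h₄⟩ := h
  refine ⟨fun e q' hq => ?_, fun e p' hp => ?_, h₄, h₃⟩
  · obtain ⟨p', hp, hr⟩ := h₂ e q' hq
    exact ⟨p', hp, hR hr⟩
  · obtain ⟨q', hq, hr⟩ := h₁ e p' hp
    exact ⟨q', hq, hR hr⟩

theorem Transfer.trans {E : Type} {R : BATC E → BATC E → Prop}
    (hR : ∀ {x y z}, R x y → R y z → R x z) {p q r : BATC E}
    (h : Transfer R p q) (k : Transfer R q r) : Transfer R p r := by
  obtain ⟨h₁, h₂, h₃, h₄⟩ := h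
  obtain ⟨k₁, k₂, k₃, k₄⟩ := k
  refine ⟨fun e p' hp => ?_, fun e r' hr => ?_, fun e he => k₃ e (h₃ e he),
    fun e he => h₄ e (k₄ e he)⟩
  · obtain ⟨q', hq, hpq⟩ := h₁ e p' hp
    obtain ⟨r', hr, hqr⟩ := k₁ e q' hq
    exact ⟨r', hr, hR hpq hqr⟩
  · obtain ⟨q', hq, hqr⟩ := k₂ e r' hr
    obtain ⟨p', hp, hpq⟩ := h₂ e q' hq
    exact ⟨p', hp, hR hpq hqr⟩

theorem Transfer.alt {E : Type} {R : BATC E → BATC E → Prop} {x x' y y' : BATC E}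
    (h : Transfer R x x') (k : Transfer R y y') : Transfer R (alt x y) (alt x' y') := by
  simp only [Transfer, tr_alt_iff] at *
  grind

theorem Transfer.seq {E : Type} {R : BATC E → BATC E → Prop} {x x' y y' : BATC E}
    (hR : ∀ {u v}, R u v → R (seq u y) (seq v y')) (h : Transfer R x x') (hy : R y y') :
    Transfer R (seq x y) (seq x' y') := by
  obtain ⟨h₁, h₂, h₃, h₄⟩ := h
  refine ⟨fun e p' hp => ?_, fun e q' hq => ?_, ?_, ?_⟩
  · cases hp with
    | seqDone _ hp => exact ⟨y', .seqDone y' (h₃ e hp), hy⟩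
    | seqStep _ hp =>
      obtain ⟨v, hv, huv⟩ := h₁ e _ hp
      exact ⟨BATC.seq v y', .seqStep y' hv, hR huv⟩
  · cases hq with
    | seqDone _ hq => exact ⟨y, .seqDone y (h₄ e hq), hy⟩
    | seqStep _ hq =>
      obtain ⟨u, hu, huv⟩ := h₂ e _ hq
      exact ⟨BATC.seq u y, .seqStep y hu, hR huv⟩
  · rintro e ⟨⟩
  · rintro e ⟨⟩

/-- Derivable equality is itself a bisimulation. -/
theorem isBisim_derEq {E : Type} : IsBisim (DerEq (E := E)) := by
  intro p q h
  change Transfer DerEq p q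
  induction h with
  | refl x => exact .of_tr_iff .refl fun _ _ => Iff.rfl
  | symm _ ih => exact ih.symm .symm
  | trans _ _ ih₁ ih₂ => exact ih₁.trans .trans ih₂
  | seq_congr _ hy ih _ => exact ih.seq (fun h => .seq_congr h hy) hy
  | alt_congr _ _ ih₁ ih₂ => exact ih₁.alt ih₂
  | A1 x y => exact .of_tr_iff .refl fun _ _ => by simp only [tr_alt_iff, or_comm]
  | A2 x y z => exact .of_tr_iff .refl fun _ _ => by simp only [tr_alt_iff, or_assoc]
  | A3 x => exact .of_tr_iff .refl fun _ _ => by simp only [tr_alt_iff, or_self]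
  | A4 x y z =>
    refine .of_tr_iff .refl fun _ _ => ?_
    simp only [tr_alt_iff, tr_seq_iff]
    grind
  | A5 x y z =>
    refine ⟨fun e p' hp => ?_, fun e q' hq => ?_, ?_, ?_⟩
    · cases hp with
      | seqDone _ hp => cases hp
      | seqStep _ hp =>
        cases hp with
        | seqDone _ hx => exact ⟨_, .seqDone _ hx, .refl _⟩
        | seqStep _ hx => exact ⟨_, .seqStep _ hx, .A5 _ y z⟩
    · cases hq with
      | seqDone _ hx => exact ⟨_, .seqStep z (.seqDone y hx), .refl _⟩
      | seqStep _ hx => exact ⟨_, .seqStep z (.seqStep y hx), .A5 _ y z⟩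
    · rintro e ⟨⟩
    · rintro e ⟨⟩

end BATC

/-- Soundness of BATC modulo bisimulation equivalence. -/
theorem batc_soundness {E : Type} (p q : BATC E) (h : BATC.DerEq p q) :
    BATC.Bisim p q := by
  exact ⟨_, BATC.isBisim_derEq, h⟩
end

section
/- (Completeness of BATC modulo bisimulation equivalence.) For all BATC terms p and q, if p ∼HM q then BATC ⊢ p = q. -/
namespace BATC

variable {E : Type}

/-- Provable summand order: `x` can be absorbed into `y`. -/
def Absorbed (x y : BATC E) : Prop := DerEq (alt x y) y

/-- The summand of a term that is contributed by a transition. -/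
def transitionTerm (e : E) : Option (BATC E) → BATC E
  | none => atom e
  | some t => seq (atom e) t

/-- The number of atoms occurring in a term. -/
def atomCount : BATC E → ℕ
  | atom _ => 1
  | seq x y => atomCount x + atomCount y
  | alt x y => atomCount x + atomCount y

theorem atomCount_pos (p : BATC E) : 0 < p.atomCount := by
  induction p <;> simp only [atomCount] <;> omega

theorem Tr.atomCount_lt {p : BATC E} {e : E} {o : Option (BATC E)} (h : Tr p e o) :
    ∀ p', o = some p' → p'.atomCount < p.atomCount := by
  induction h with
  | ax e => intro p' hp; cases hp
  | altL y _ ih => intro p' hp; have := ih p' hp; simp only [atomCount]; omega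
  | altR x _ ih => intro p' hp; have := ih p' hp; simp only [atomCount]; omega
  | @seqDone x _ y _ _ =>
    rintro p' ⟨⟩
    have := atomCount_pos x
    simp only [atomCount]
    omega
  | seqStep y _ ih => rintro p' ⟨⟩; have := ih _ rfl; simp only [atomCount]; omega

theorem DerEq.absorbed {x y : BATC E} (h : DerEq x y) : Absorbed x y :=
  (h.alt_congr (.refl y)).trans (.A3 y)

namespace Absorbed

theorem trans {x y z : BATC E} (hxy : Absorbed x y) (hyz : Absorbed y z) : Absorbed x z :=
  ((DerEq.refl x).alt_congr hyz.symm).trans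
    ((DerEq.A2 x y z).symm.trans ((hxy.alt_congr (.refl z)).trans hyz))

theorem antisymm {x y : BATC E} (hxy : Absorbed x y) (hyx : Absorbed y x) : DerEq x y :=
  hyx.symm.trans ((DerEq.A1 y x).trans hxy)

theorem alt_le {x y z : BATC E} (hx : Absorbed x z) (hy : Absorbed y z) :
    Absorbed (alt x y) z :=
  (DerEq.A2 x y z).trans (((DerEq.refl x).alt_congr hy).trans hx)

theorem le_alt_left (x y : BATC E) : Absorbed x (alt x y) :=
  (DerEq.A2 x x y).symm.trans ((DerEq.A3 x).alt_congr (.refl y))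

theorem le_alt_right (x y : BATC E) : Absorbed y (alt x y) :=
  (le_alt_left y x).trans (DerEq.A1 y x).absorbed

theorem seq_left {x y : BATC E} (h : Absorbed x y) (z : BATC E) :
    Absorbed (seq x z) (seq y z) :=
  (DerEq.A4 x y z).symm.trans (h.seq_congr (.refl z))

end Absorbed

theorem Tr.absorbed {p : BATC E} {e : E} {o : Option (BATC E)} (h : Tr p e o) :
    Absorbed (transitionTerm e o) p := by
  induction h with
  | ax e => exact (DerEq.refl _).absorbed
  | altL y _ ih => exact ih.trans (.le_alt_left _ _)
  | altR x _ ih => exact ih.trans (.le_alt_right _ _)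
  | seqDone y _ ih => exact ih.seq_left y
  | seqStep y _ ih => exact (DerEq.A5 _ _ _).symm.absorbed.trans (ih.seq_left y)

theorem seq_absorbed_of_forall_tr (p : BATC E) : ∀ y z : BATC E,
    (∀ e o, Tr (seq p y) e o → Absorbed (transitionTerm e o) z) → Absorbed (seq p y) z := by
  induction p with
  | atom e => exact fun y z h => h e _ (.seqDone y (.ax e))
  | alt a b iha ihb =>
    intro y z h
    refine (DerEq.A4 a b y).absorbed.trans (.alt_le (iha y z ?_) (ihb y z ?_))
    · rintro e o (_ | _ | _ | ⟨_, ht⟩ | ⟨_, ht⟩)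
      · exact h e _ (.seqDone y (.altL b ht))
      · exact h e _ (.seqStep y (.altL b ht))
    · rintro e o (_ | _ | _ | ⟨_, ht⟩ | ⟨_, ht⟩)
      · exact h e _ (.seqDone y (.altR a ht))
      · exact h e _ (.seqStep y (.altR a ht))
  | seq a b iha _ =>
    intro y z h
    refine (DerEq.A5 a b y).absorbed.trans (iha _ z ?_)
    rintro e o (_ | _ | _ | ⟨_, ht⟩ | ⟨_, ht⟩)
    · exact h e _ (.seqStep y (.seqDone b ht))
    · exact ((DerEq.refl _).seq_congr (DerEq.A5 _ b y).symm).absorbed.trans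
        (h e _ (.seqStep y (.seqStep b ht)))

theorem absorbed_of_forall_tr (p z : BATC E)
    (h : ∀ e o, Tr p e o → Absorbed (transitionTerm e o) z) : Absorbed p z := by
  induction p with
  | atom e => exact h e none (.ax e)
  | alt a b iha ihb =>
    exact .alt_le (iha fun e o ht => h e o (.altL b ht)) (ihb fun e o ht => h e o (.altR a ht))
  | seq a b => exact seq_absorbed_of_forall_tr a b z h

theorem IsBisim.derEq {R : BATC E → BATC E → Prop} (hR : IsBisim R) (p q : BATC E)
    (h : R p q) : DerEq p q := by
  obtain ⟨hpq, hqp, hpq_done, hqp_done⟩ := hR p q h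
  refine (absorbed_of_forall_tr p q ?_).antisymm (absorbed_of_forall_tr q p ?_)
  · rintro e (_ | p') ht
    · exact (hpq_done e ht).absorbed
    · obtain ⟨q', hq, hr⟩ := hpq e p' ht
      have := ht.atomCount_lt p' rfl
      exact ((DerEq.refl _).seq_congr (hR.derEq p' q' hr)).absorbed.trans hq.absorbed
  · rintro e (_ | q') ht
    · exact (hqp_done e ht).absorbed
    · obtain ⟨p', hp, hr⟩ := hqp e q' ht
      have := hp.atomCount_lt p' rfl
      exact ((DerEq.refl _).seq_congr (hR.derEq p' q' hr).symm).absorbed.trans hp.absorbed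
termination_by p.atomCount

end BATC

/-- Completeness of BATC modulo bisimulation equivalence. -/
theorem batc_completeness {E : Type} (p q : BATC E) (h : BATC.Bisim p q) :
    BATC.DerEq p q := by
  obtain ⟨R, hR, hpq⟩ := h
  exact hR.derEq p q hpq
end

section
/- (Milner's expansion law fails modulo truly concurrent (step) bisimulation.) For all atomic events e1, e2 the APTC terms e1∥e2 and e1·e2 + e2·e1 are NOT step bisimilar: e1∥e2 has the step transition e1∥e2 →{e1,e2} √ whereas e1·e2 + e2·e1 has no transition labelled by the two-element multiset {e1,e2}. In particular (auto-concurrency), for every atomic event e, the terms e∥e and e·e are not step bisimilar. -/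
/-- Terms of the parallelism fragment of APTC over a type `E` of atomic events:
`t ::= e | δ | t·t | t+t | t∥t | t∣t | t≬t`. -/
inductive APTC (E : Type) : Type
  | atom : E → APTC E
  | delta : APTC E
  | seq : APTC E → APTC E → APTC E
  | alt : APTC E → APTC E → APTC E
  | par : APTC E → APTC E → APTC E
  | comm : APTC E → APTC E → APTC E
  | merge : APTC E → APTC E → APTC E

namespace APTC

variable {E : Type}

/-- Interpret a value of the communication function (`none` = deadlock δ) as a term. -/
def ofOpt : Option E → APTC E
  | none => delta
  | some e => atom e

/-- Step transitions `t →X t'` (target `some t'`) and `t →X √` (target `none`),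
labelled by nonempty finite multisets `X` over `E`; `γ` is the communication function
(`γ e1 e2 = none` means the communication is the deadlock δ). -/
inductive STr (γ : E → E → Option E) : APTC E → Multiset E → Option (APTC E) → Prop
  | ax (e : E) : STr γ (atom e) {e} none
  | altL {x : APTC E} {X : Multiset E} {o : Option (APTC E)} (y : APTC E) :
      STr γ x X o → STr γ (alt x y) X o
  | altR (x : APTC E) {y : APTC E} {X : Multiset E} {o : Option (APTC E)} :
      STr γ y X o → STr γ (alt x y) X o
  | seqDone {x : APTC E} {X : Multiset E} (y : APTC E) :
      STr γ x X none → STr γ (seq x y) X (some y)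
  | seqStep {x x' : APTC E} {X : Multiset E} (y : APTC E) :
      STr γ x X (some x') → STr γ (seq x y) X (some (seq x' y))
  | parDD {x y : APTC E} {X Y : Multiset E} :
      STr γ x X none → STr γ y Y none → STr γ (par x y) (X + Y) none
  | parSD {x y x' : APTC E} {X Y : Multiset E} :
      STr γ x X (some x') → STr γ y Y none → STr γ (par x y) (X + Y) (some x')
  | parDS {x y y' : APTC E} {X Y : Multiset E} :
      STr γ x X none → STr γ y Y (some y') → STr γ (par x y) (X + Y) (some y')
  | parSS {x y x' y' : APTC E} {X Y : Multiset E} :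
      STr γ x X (some x') → STr γ y Y (some y') →
      STr γ (par x y) (X + Y) (some (merge x' y'))
  | commDD {x y : APTC E} {e1 e2 c : E} :
      STr γ x {e1} none → STr γ y {e2} none → γ e1 e2 = some c →
      STr γ (comm x y) {c} none
  | commSD {x y x' : APTC E} {e1 e2 c : E} :
      STr γ x {e1} (some x') → STr γ y {e2} none → γ e1 e2 = some c →
      STr γ (comm x y) {c} (some x')
  | commDS {x y y' : APTC E} {e1 e2 c : E} :
      STr γ x {e1} none → STr γ y {e2} (some y') → γ e1 e2 = some c →
      STr γ (comm x y) {c} (some y')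
  | commSS {x y x' y' : APTC E} {e1 e2 c : E} :
      STr γ x {e1} (some x') → STr γ y {e2} (some y') → γ e1 e2 = some c →
      STr γ (comm x y) {c} (some (merge x' y'))
  | mergePar {x y : APTC E} {X : Multiset E} {o : Option (APTC E)} :
      STr γ (par x y) X o → STr γ (merge x y) X o
  | mergeComm {x y : APTC E} {X : Multiset E} {o : Option (APTC E)} :
      STr γ (comm x y) X o → STr γ (merge x y) X o

/-- `R` is a step bisimulation. -/
def IsStepBisim (γ : E → E → Option E) (R : APTC E → APTC E → Prop) : Prop :=
  ∀ p q, R p q →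
    (∀ X p', STr γ p X (some p') → ∃ q', STr γ q X (some q') ∧ R p' q') ∧
    (∀ X q', STr γ q X (some q') → ∃ p', STr γ p X (some p') ∧ R p' q') ∧
    (∀ X, STr γ p X none → STr γ q X none) ∧
    (∀ X, STr γ q X none → STr γ p X none)

/-- Step bisimilarity `p ∼s q`. -/
def StepBisim (γ : E → E → Option E) (p q : APTC E) : Prop :=
  ∃ R, IsStepBisim γ R ∧ R p q

/-- APTC-derivable equality: the least congruence containing axioms
A1–A7, P1–P10 and C11–C18. -/
inductive AEq (γ : E → E → Option E) : APTC E → APTC E → Prop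
  | refl (x : APTC E) : AEq γ x x
  | symm {x y : APTC E} : AEq γ x y → AEq γ y x
  | trans {x y z : APTC E} : AEq γ x y → AEq γ y z → AEq γ x z
  | seq_congr {x x' y y' : APTC E} : AEq γ x x' → AEq γ y y' → AEq γ (seq x y) (seq x' y')
  | alt_congr {x x' y y' : APTC E} : AEq γ x x' → AEq γ y y' → AEq γ (alt x y) (alt x' y')
  | par_congr {x x' y y' : APTC E} : AEq γ x x' → AEq γ y y' → AEq γ (par x y) (par x' y')
  | comm_congr {x x' y y' : APTC E} : AEq γ x x' → AEq γ y y' → AEq γ (comm x y) (comm x' y')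
  | merge_congr {x x' y y' : APTC E} : AEq γ x x' → AEq γ y y' → AEq γ (merge x y) (merge x' y')
  | A1 (x y : APTC E) : AEq γ (alt x y) (alt y x)
  | A2 (x y z : APTC E) : AEq γ (alt (alt x y) z) (alt x (alt y z))
  | A3 (x : APTC E) : AEq γ (alt x x) x
  | A4 (x y z : APTC E) : AEq γ (seq (alt x y) z) (alt (seq x z) (seq y z))
  | A5 (x y z : APTC E) : AEq γ (seq (seq x y) z) (seq x (seq y z))
  | A6 (x : APTC E) : AEq γ (alt x delta) x
  | A7 (x : APTC E) : AEq γ (seq delta x) delta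
  | P1 (x y : APTC E) : AEq γ (merge x y) (alt (par x y) (comm x y))
  | P2 (x y : APTC E) : AEq γ (par x y) (par y x)
  | P3 (x y z : APTC E) : AEq γ (par (par x y) z) (par x (par y z))
  | P4 (e1 e2 : E) (y : APTC E) :
      AEq γ (par (atom e1) (seq (atom e2) y)) (seq (par (atom e1) (atom e2)) y)
  | P5 (e1 e2 : E) (x : APTC E) :
      AEq γ (par (seq (atom e1) x) (atom e2)) (seq (par (atom e1) (atom e2)) x)
  | P6 (e1 e2 : E) (x y : APTC E) :
      AEq γ (par (seq (atom e1) x) (seq (atom e2) y))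
            (seq (par (atom e1) (atom e2)) (merge x y))
  | P7 (x y z : APTC E) : AEq γ (par (alt x y) z) (alt (par x z) (par y z))
  | P8 (x y z : APTC E) : AEq γ (par x (alt y z)) (alt (par x y) (par x z))
  | P9 (x : APTC E) : AEq γ (par delta x) delta
  | P10 (x : APTC E) : AEq γ (par x delta) delta
  | C11 (e1 e2 : E) : AEq γ (comm (atom e1) (atom e2)) (ofOpt (γ e1 e2))
  | C12 (e1 e2 : E) (y : APTC E) :
      AEq γ (comm (atom e1) (seq (atom e2) y)) (seq (ofOpt (γ e1 e2)) y)
  | C13 (e1 e2 : E) (x : APTC E) :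
      AEq γ (comm (seq (atom e1) x) (atom e2)) (seq (ofOpt (γ e1 e2)) x)
  | C14 (e1 e2 : E) (x y : APTC E) :
      AEq γ (comm (seq (atom e1) x) (seq (atom e2) y))
            (seq (ofOpt (γ e1 e2)) (merge x y))
  | C15 (x y z : APTC E) : AEq γ (comm (alt x y) z) (alt (comm x z) (comm y z))
  | C16 (x y z : APTC E) : AEq γ (comm x (alt y z)) (alt (comm x y) (comm x z))
  | C17 (x : APTC E) : AEq γ (comm delta x) delta
  | C18 (x : APTC E) : AEq γ (comm x delta) delta

/-- Basic APTC terms. -/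
inductive Basic : APTC E → Prop
  | delta : Basic delta
  | atom (e : E) : Basic (atom e)
  | seqAtom (e : E) {t : APTC E} : Basic t → Basic (seq (atom e) t)
  | alt {s t : APTC E} : Basic s → Basic t → Basic (alt s t)
  | par {s t : APTC E} : Basic s → Basic t → Basic (par s t)

end APTC

namespace APTC

theorem STr.eq_singleton_of_atom {E : Type} {γ : E → E → Option E} {e : E} {X : Multiset E}
    {o : Option (APTC E)} (h : STr γ (atom e) X o) : X = {e} := by
  cases h
  rfl

theorem STr.card_eq_one_of_seq_atom {E : Type} {γ : E → E → Option E} {e : E} {y : APTC E}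
    {X : Multiset E} {o : Option (APTC E)} (h : STr γ (seq (atom e) y) X o) : X.card = 1 := by
  cases h with
  | seqDone _ h | seqStep _ h => simp [h.eq_singleton_of_atom]

theorem STr.par_atom_atom {E : Type} (γ : E → E → Option E) (e₁ e₂ : E) :
    STr γ (par (atom e₁) (atom e₂)) {e₁, e₂} none :=
  .parDD (.ax e₁) (.ax e₂)

theorem StepBisim.done {E : Type} {γ : E → E → Option E} {p q : APTC E} (h : StepBisim γ p q)
    {X : Multiset E} (hp : STr γ p X none) : STr γ q X none := by
  obtain ⟨R, hR, hpq⟩ := h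
  exact (hR p q hpq).2.2.1 X hp

end APTC

open APTC in
/-- Milner's expansion law fails modulo step bisimulation: `e1∥e2` has the step
transition labelled `{e1,e2}` to `√`, while `e1·e2 + e2·e1` has no transition
labelled by the two-element multiset `{e1,e2}`; hence they are not step bisimilar,
and in particular `e∥e` and `e·e` are not step bisimilar. -/
theorem milner_expansion_law_fails {E : Type} (γ : E → E → Option E) (e1 e2 : E) :
    STr γ (par (atom e1) (atom e2)) ({e1, e2} : Multiset E) none ∧
    (∀ o : Option (APTC E),
      ¬ STr γ (alt (seq (atom e1) (atom e2)) (seq (atom e2) (atom e1)))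
          ({e1, e2} : Multiset E) o) ∧
    ¬ StepBisim γ (par (atom e1) (atom e2))
        (alt (seq (atom e1) (atom e2)) (seq (atom e2) (atom e1))) ∧
    (∀ e : E, ¬ StepBisim γ (par (atom e) (atom e)) (seq (atom e) (atom e))) := by
  have no_pair : ∀ o : Option (APTC E),
      ¬ STr γ (alt (seq (atom e1) (atom e2)) (seq (atom e2) (atom e1)))
          ({e1, e2} : Multiset E) o := by
    intro o h
    cases h with
    | altL _ h | altR _ h => simpa using h.card_eq_one_of_seq_atom
  refine ⟨STr.par_atom_atom γ e1 e2, no_pair,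
    fun h => no_pair none (h.done (STr.par_atom_atom γ e1 e2)), fun e h => ?_⟩
  simpa using (h.done (STr.par_atom_atom γ e e)).card_eq_one_of_seq_atom
end

section
/- (Failure of distributivity between · and ∥ modulo step bisimulation.) For all atomic events e1, e2, e3: (1) (e1·e2)∥(e1·e3) is not step bisimilar to e1·(e2∥e3); (2) (e1·e3)∥(e2·e3) is not step bisimilar to (e1∥e2)·e3; (3) (e1∥e2)·(e1∥e3) is not step bisimilar to e1∥(e2·e3); (4) (e1∥e3)·(e2∥e3) is not step bisimilar to (e1·e2)∥e3. Hence neither the left nor the right distributivity of · over ∥, nor of ∥ over ·, holds modulo step bisimulation. -/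
namespace APTC

variable {E : Type} {γ : E → E → Option E}

theorem StepBisim.exists_step {p q p' : APTC E} {X : Multiset E} (h : StepBisim γ p q)
    (hp : STr γ p X (some p')) : ∃ q', STr γ q X (some q') ∧ StepBisim γ p' q' := by
  obtain ⟨R, hR, hpq⟩ := h
  obtain ⟨q', hq, hpq'⟩ := (hR p q hpq).1 X p' hp
  exact ⟨q', hq, R, hR, hpq'⟩

theorem StepBisim.terminates {p q : APTC E} {X : Multiset E} (h : StepBisim γ p q)
    (hp : STr γ p X none) : STr γ q X none := by
  obtain ⟨R, hR, hpq⟩ := h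
  exact (hR p q hpq).2.2.1 X hp

theorem STr.of_atom {e : E} {X : Multiset E} {o : Option (APTC E)} (h : STr γ (atom e) X o) :
    X = {e} ∧ o = none := by
  cases h
  exact ⟨rfl, rfl⟩

theorem STr.par_atom (a b : E) : STr γ (par (atom a) (atom b)) ({a} + {b}) none :=
  .parDD (.ax a) (.ax b)

theorem STr.seq_atom (a : E) (y : APTC E) : STr γ (seq (atom a) y) {a} (some y) :=
  .seqDone y (.ax a)

theorem STr.of_seq_atom {a : E} {y : APTC E} {X : Multiset E} {o : Option (APTC E)}
    (h : STr γ (seq (atom a) y) X o) : X = {a} ∧ o = some y := by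
  cases h with
  | seqDone _ h => exact ⟨h.of_atom.1, rfl⟩
  | seqStep _ h => cases h

/-- An atom cannot match a step that terminates after two simultaneous events. -/
theorem not_stepBisim_atom {p : APTC E} {a b e : E} (hp : STr γ p ({a} + {b}) none) :
    ¬ StepBisim γ p (atom e) := fun h => by
  simpa using congrArg Multiset.card (h.terminates hp).of_atom.1

end APTC

open APTC in
/-- Failure of distributivity between `·` and `∥` modulo step bisimulation. -/
theorem distributivity_fails_step_bisim {E : Type} (γ : E → E → Option E) (e1 e2 e3 : E) :
    ¬ StepBisim γ (par (seq (atom e1) (atom e2)) (seq (atom e1) (atom e3)))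
        (seq (atom e1) (par (atom e2) (atom e3))) ∧
    ¬ StepBisim γ (par (seq (atom e1) (atom e3)) (seq (atom e2) (atom e3)))
        (seq (par (atom e1) (atom e2)) (atom e3)) ∧
    ¬ StepBisim γ (seq (par (atom e1) (atom e2)) (par (atom e1) (atom e3)))
        (par (atom e1) (seq (atom e2) (atom e3))) ∧
    ¬ StepBisim γ (seq (par (atom e1) (atom e3)) (par (atom e2) (atom e3)))
        (par (seq (atom e1) (atom e2)) (atom e3)) := by
  refine ⟨fun h => ?_, fun h => ?_, fun h => ?_, fun h => ?_⟩
  · obtain ⟨q, hq, -⟩ := h.exists_step (.parSS (.seq_atom e1 _) (.seq_atom e1 _))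
    simpa using congrArg Multiset.card hq.of_seq_atom.1
  · obtain ⟨q, hq, hb⟩ := h.exists_step (.parSS (.seq_atom e1 _) (.seq_atom e2 _))
    generalize ({e1} + {e2} : Multiset E) = X at hq
    cases hq with
    | seqDone => exact not_stepBisim_atom (.mergePar (.par_atom e3 e3)) hb
    | seqStep _ h =>
      cases h with
      | parSD h _ | parDS _ h | parSS h _ => cases h
  · obtain ⟨q, hq, hb⟩ := h.exists_step (.seqDone _ (.par_atom e1 e2))
    generalize ({e1} + {e2} : Multiset E) = X at hq
    cases hq with
    | parDS _ h =>
      cases h.of_seq_atom.2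
      exact not_stepBisim_atom (.par_atom e1 e3) hb
    | parSD h _ | parSS h _ => cases h
  · obtain ⟨q, hq, hb⟩ := h.exists_step (.seqDone _ (.par_atom e1 e3))
    generalize ({e1} + {e3} : Multiset E) = X at hq
    cases hq with
    | parSD h _ =>
      cases h.of_seq_atom.2
      exact not_stepBisim_atom (.par_atom e2 e3) hb
    | parDS _ h | parSS _ h => cases h
end

section
/- (Congruence theorem of APTC for step bisimulation.) Step bisimilarity ∼s is an equivalence relation on terms of the parallelism fragment of APTC and a congruence with respect to all its operators: if p ∼s p' and q ∼s q' then p+q ∼s p'+q', p·q ∼s p'·q', p∥q ∼s p'∥q', p∣q ∼s p'∣q', and p≬q ∼s p'≬q'. -/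
namespace APTC

variable {E : Type} {γ : E → E → Option E}

/-- A symmetric relation along which every transition can be matched is a step bisimulation. -/
theorem IsStepBisim.of_symm {R : APTC E → APTC E → Prop} (symm : ∀ {p q}, R p q → R q p)
    (step : ∀ {p q}, R p q → ∀ X p', STr γ p X (some p') → ∃ q', STr γ q X (some q') ∧ R p' q')
    (term : ∀ {p q}, R p q → ∀ X, STr γ p X none → STr γ q X none) : IsStepBisim γ R := by
  refine fun p q h ↦ ⟨step h, fun X q' hq ↦ ?_, term h, term (symm h)⟩
  obtain ⟨p', hp, hr⟩ := step (symm h) X q' hq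
  exact ⟨p', hp, symm hr⟩

namespace StepBisim

theorem refl (p : APTC E) : StepBisim γ p p := by
  refine ⟨Eq, .of_symm Eq.symm ?_ ?_, rfl⟩
  · rintro p _ rfl X p' h
    exact ⟨p', h, rfl⟩
  · rintro p _ rfl X h
    exact h

theorem symm {p q : APTC E} : StepBisim γ p q → StepBisim γ q p := by
  rintro ⟨R, hR, h⟩
  exact ⟨flip R, fun p q h ↦ let ⟨h₁, h₂, h₃, h₄⟩ := hR q p h; ⟨h₂, h₁, h₄, h₃⟩, h⟩

theorem exists_step_s10 {p q : APTC E} (h : StepBisim γ p q) {X : Multiset E} {p' : APTC E}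
    (hp : STr γ p X (some p')) : ∃ q', STr γ q X (some q') ∧ StepBisim γ p' q' := by
  obtain ⟨R, hR, h⟩ := h
  obtain ⟨q', hq, hr⟩ := (hR p q h).1 X p' hp
  exact ⟨q', hq, R, hR, hr⟩

theorem term {p q : APTC E} (h : StepBisim γ p q) {X : Multiset E} (hp : STr γ p X none) :
    STr γ q X none := by
  obtain ⟨R, hR, h⟩ := h
  exact (hR p q h).2.2.1 X hp

theorem trans {p q r : APTC E} (hpq : StepBisim γ p q) (hqr : StepBisim γ q r) :
    StepBisim γ p r := by
  refine ⟨fun p r ↦ ∃ q, StepBisim γ p q ∧ StepBisim γ q r, .of_symm ?_ ?_ ?_, q, hpq, hqr⟩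
  · rintro p r ⟨q, h₁, h₂⟩
    exact ⟨q, h₂.symm, h₁.symm⟩
  · rintro p r ⟨q, h₁, h₂⟩ X p' hp
    obtain ⟨q', hq, h₁⟩ := h₁.exists_step_s10 hp
    obtain ⟨r', hr, h₂⟩ := h₂.exists_step_s10 hq
    exact ⟨r', hr, q', h₁, h₂⟩
  · rintro p r ⟨q, h₁, h₂⟩ X hp
    exact h₂.term (h₁.term hp)

end StepBisim

/-- The closure of step bisimilarity under all operators. -/
inductive CongrClosure (γ : E → E → Option E) : APTC E → APTC E → Prop
  | alt {p p' q q' : APTC E} : CongrClosure γ p p' → CongrClosure γ q q' →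
      CongrClosure γ (alt p q) (alt p' q')
  | seq {p p' q q' : APTC E} : CongrClosure γ p p' → CongrClosure γ q q' →
      CongrClosure γ (seq p q) (seq p' q')
  | par {p p' q q' : APTC E} : CongrClosure γ p p' → CongrClosure γ q q' →
      CongrClosure γ (par p q) (par p' q')
  | comm {p p' q q' : APTC E} : CongrClosure γ p p' → CongrClosure γ q q' →
      CongrClosure γ (comm p q) (comm p' q')
  | merge {p p' q q' : APTC E} : CongrClosure γ p p' → CongrClosure γ q q' →
      CongrClosure γ (merge p q) (merge p' q')
  | of {p q : APTC E} : StepBisim γ p q → CongrClosure γ p q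

/-- `q` terminates whenever `p` does, and matches the steps of `p` up to `R`. -/
def Simulates (γ : E → E → Option E) (R : APTC E → APTC E → Prop) (p q : APTC E) : Prop :=
  (∀ X p', STr γ p X (some p') → ∃ q', STr γ q X (some q') ∧ R p' q') ∧
    ∀ X, STr γ p X none → STr γ q X none

namespace Simulates

variable {R : APTC E → APTC E → Prop} {p p' q q' : APTC E}

theorem alt (hp : Simulates γ R p p') (hq : Simulates γ R q q') :
    Simulates γ R (alt p q) (alt p' q') := by
  refine ⟨fun X r h ↦ ?_, fun X h ↦ ?_⟩
  · cases h with
    | altL _ h =>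
      obtain ⟨r', h, hr⟩ := hp.1 _ _ h
      exact ⟨r', .altL _ h, hr⟩
    | altR _ h =>
      obtain ⟨r', h, hr⟩ := hq.1 _ _ h
      exact ⟨r', .altR _ h, hr⟩
  · cases h with
    | altL _ h => exact .altL _ (hp.2 _ h)
    | altR _ h => exact .altR _ (hq.2 _ h)

theorem seq (hR : ∀ {x x'}, R x x' → R (seq x q) (seq x' q')) (hp : Simulates γ R p p')
    (hq : R q q') : Simulates γ R (seq p q) (seq p' q') := by
  refine ⟨fun X r h ↦ ?_, fun X h ↦ nomatch h⟩
  cases h with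
  | seqDone _ h => exact ⟨q', .seqDone _ (hp.2 _ h), hq⟩
  | seqStep _ h =>
    obtain ⟨r', h, hr⟩ := hp.1 _ _ h
    exact ⟨_, .seqStep _ h, hR hr⟩

theorem par (hR : ∀ {x x' y y'}, R x x' → R y y' → R (merge x y) (merge x' y'))
    (hp : Simulates γ R p p') (hq : Simulates γ R q q') :
    Simulates γ R (par p q) (par p' q') := by
  refine ⟨fun X r h ↦ ?_, fun X h ↦ ?_⟩
  · cases h with
    | parSD h₁ h₂ =>
      obtain ⟨r', h₁, hr⟩ := hp.1 _ _ h₁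
      exact ⟨r', .parSD h₁ (hq.2 _ h₂), hr⟩
    | parDS h₁ h₂ =>
      obtain ⟨r', h₂, hr⟩ := hq.1 _ _ h₂
      exact ⟨r', .parDS (hp.2 _ h₁) h₂, hr⟩
    | parSS h₁ h₂ =>
      obtain ⟨r₁, h₁, hr₁⟩ := hp.1 _ _ h₁
      obtain ⟨r₂, h₂, hr₂⟩ := hq.1 _ _ h₂
      exact ⟨_, .parSS h₁ h₂, hR hr₁ hr₂⟩
  · cases h with
    | parDD h₁ h₂ => exact .parDD (hp.2 _ h₁) (hq.2 _ h₂)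

theorem comm (hR : ∀ {x x' y y'}, R x x' → R y y' → R (merge x y) (merge x' y'))
    (hp : Simulates γ R p p') (hq : Simulates γ R q q') :
    Simulates γ R (comm p q) (comm p' q') := by
  refine ⟨fun X r h ↦ ?_, fun X h ↦ ?_⟩
  · cases h with
    | commSD h₁ h₂ hc =>
      obtain ⟨r', h₁, hr⟩ := hp.1 _ _ h₁
      exact ⟨r', .commSD h₁ (hq.2 _ h₂) hc, hr⟩
    | commDS h₁ h₂ hc =>
      obtain ⟨r', h₂, hr⟩ := hq.1 _ _ h₂
      exact ⟨r', .commDS (hp.2 _ h₁) h₂ hc, hr⟩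
    | commSS h₁ h₂ hc =>
      obtain ⟨r₁, h₁, hr₁⟩ := hp.1 _ _ h₁
      obtain ⟨r₂, h₂, hr₂⟩ := hq.1 _ _ h₂
      exact ⟨_, .commSS h₁ h₂ hc, hR hr₁ hr₂⟩
  · cases h with
    | commDD h₁ h₂ hc => exact .commDD (hp.2 _ h₁) (hq.2 _ h₂) hc

theorem merge (hR : ∀ {x x' y y'}, R x x' → R y y' → R (merge x y) (merge x' y'))
    (hp : Simulates γ R p p') (hq : Simulates γ R q q') :
    Simulates γ R (merge p q) (merge p' q') := by
  refine ⟨fun X r h ↦ ?_, fun X h ↦ ?_⟩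
  · cases h with
    | mergePar h =>
      obtain ⟨r', h, hr⟩ := (par hR hp hq).1 _ _ h
      exact ⟨r', .mergePar h, hr⟩
    | mergeComm h =>
      obtain ⟨r', h, hr⟩ := (comm hR hp hq).1 _ _ h
      exact ⟨r', .mergeComm h, hr⟩
  · cases h with
    | mergePar h => exact .mergePar ((par hR hp hq).2 _ h)
    | mergeComm h => exact .mergeComm ((comm hR hp hq).2 _ h)

end Simulates

namespace CongrClosure

theorem symm {p q : APTC E} (h : CongrClosure γ p q) : CongrClosure γ q p := by
  induction h with
  | of h => exact of h.symm
  | alt _ _ hp hq => exact alt hp hq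
  | seq _ _ hp hq => exact seq hp hq
  | par _ _ hp hq => exact par hp hq
  | comm _ _ hp hq => exact comm hp hq
  | merge _ _ hp hq => exact merge hp hq

theorem simulates {p q : APTC E} (h : CongrClosure γ p q) :
    Simulates γ (CongrClosure γ) p q := by
  induction h with
  | of h =>
    refine ⟨fun X p' hp ↦ ?_, fun X hp ↦ h.term hp⟩
    obtain ⟨q', hq, hr⟩ := h.exists_step_s10 hp
    exact ⟨q', hq, of hr⟩
  | alt _ _ hp hq => exact hp.alt hq
  | seq _ h hp _ => exact hp.seq (fun hx ↦ seq hx h) h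
  | par _ _ hp hq => exact hp.par merge hq
  | comm _ _ hp hq => exact hp.comm merge hq
  | merge _ _ hp hq => exact hp.merge merge hq

theorem stepBisim {p q : APTC E} (h : CongrClosure γ p q) : StepBisim γ p q :=
  ⟨CongrClosure γ, .of_symm symm (fun h ↦ h.simulates.1) (fun h ↦ h.simulates.2), h⟩

end CongrClosure

end APTC

open APTC in
/-- Step bisimilarity is an equivalence relation on terms of the parallelism
fragment of APTC and a congruence with respect to all its operators. -/
theorem aptc_stepBisim_congruence {E : Type} (γ : E → E → Option E) :
    Equivalence (StepBisim γ (E := E)) ∧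
    ∀ p p' q q' : APTC E, StepBisim γ p p' → StepBisim γ q q' →
      StepBisim γ (alt p q) (alt p' q') ∧
      StepBisim γ (seq p q) (seq p' q') ∧
      StepBisim γ (par p q) (par p' q') ∧
      StepBisim γ (comm p q) (comm p' q') ∧
      StepBisim γ (merge p q) (merge p' q') := by
  exact ⟨⟨StepBisim.refl, StepBisim.symm, StepBisim.trans⟩, fun p p' q q' hp hq ↦
    ⟨(CongrClosure.alt (.of hp) (.of hq)).stepBisim,
      (CongrClosure.seq (.of hp) (.of hq)).stepBisim,
      (CongrClosure.par (.of hp) (.of hq)).stepBisim,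
      (CongrClosure.comm (.of hp) (.of hq)).stepBisim,
      (CongrClosure.merge (.of hp) (.of hq)).stepBisim⟩⟩
end

section
/- (Soundness of RDP and RSP modulo step bisimulation.) Let E : Xi = ti(X1, …, Xn) (i = 1, …, n) be a linear recursive specification over APTC. Then: (RDP) ⟨Xi|E⟩ ∼s ti(⟨X1|E⟩, …, ⟨Xn|E⟩) for every i ∈ {1, …, n}; and (RSP, uniqueness of solutions) if closed terms p1, …, pn of APTC with linear recursion satisfy pi ∼s ti(p1, …, pn) for every i, then pi ∼s ⟨Xi|E⟩ for every i. -/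
/-- A linear recursive specification over recursion variables `X 0, …, X (n-1)`:
each right-hand side is a finite sum (a list) of summands; a summand
`((a, as), some j)` stands for `(a ∥ a₁ ∥ ⋯ ∥ aₖ) · Xⱼ` and `((a, as), none)`
stands for `a ∥ a₁ ∥ ⋯ ∥ aₖ` (the action prefix is nonempty by construction;
the empty sum denotes the deadlock δ). -/
structure LinearSpec (E : Type) where
  n : ℕ
  rhs : Fin n → List ((E × List E) × Option (Fin n))

/-- Terms of the parallelism fragment of APTC extended with the recursion
constants `⟨Xᵢ|S⟩` for linear recursive specifications `S`. -/
inductive APTCr (E : Type) : Type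
  | atom : E → APTCr E
  | delta : APTCr E
  | seq : APTCr E → APTCr E → APTCr E
  | alt : APTCr E → APTCr E → APTCr E
  | par : APTCr E → APTCr E → APTCr E
  | comm : APTCr E → APTCr E → APTCr E
  | merge : APTCr E → APTCr E → APTCr E
  | recvar : (S : LinearSpec E) → Fin S.n → APTCr E

namespace APTCr

variable {E : Type}

/-- The term `a₁ ∥ ⋯ ∥ aₖ` for a nonempty list of atomic events. -/
def parOfList (p : E × List E) : APTCr E :=
  p.2.foldl (fun t b => par t (atom b)) (atom p.1)

/-- Finite sum of a list of terms; the empty sum denotes the deadlock δ. -/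
def sumList : List (APTCr E) → APTCr E
  | [] => delta
  | [t] => t
  | t :: ts => alt t (sumList ts)

/-- The right-hand side `tᵢ(p 0, …, p (n-1))` of the `i`-th equation of `S`, with the
recursion variables instantiated by the terms `p j`. -/
def rhsTermWith (S : LinearSpec E) (p : Fin S.n → APTCr E) (i : Fin S.n) : APTCr E :=
  sumList ((S.rhs i).map fun s =>
    match s.2 with
    | none => parOfList s.1
    | some j => seq (parOfList s.1) (p j))

/-- The term `tᵢ(⟨X₁|S⟩, …, ⟨Xₙ|S⟩)`. -/
def rhsTerm (S : LinearSpec E) (i : Fin S.n) : APTCr E :=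
  rhsTermWith S (recvar S) i

/-- Step transitions `t →X t'` (target `some t'`) and `t →X √` (target `none`),
labelled by nonempty finite multisets `X` over `E`; `γ` is the communication function. -/
inductive STr (γ : E → E → Option E) : APTCr E → Multiset E → Option (APTCr E) → Prop
  | ax (e : E) : STr γ (atom e) {e} none
  | altL {x : APTCr E} {X : Multiset E} {o : Option (APTCr E)} (y : APTCr E) :
      STr γ x X o → STr γ (alt x y) X o
  | altR (x : APTCr E) {y : APTCr E} {X : Multiset E} {o : Option (APTCr E)} :
      STr γ y X o → STr γ (alt x y) X o
  | seqDone {x : APTCr E} {X : Multiset E} (y : APTCr E) :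
      STr γ x X none → STr γ (seq x y) X (some y)
  | seqStep {x x' : APTCr E} {X : Multiset E} (y : APTCr E) :
      STr γ x X (some x') → STr γ (seq x y) X (some (seq x' y))
  | parDD {x y : APTCr E} {X Y : Multiset E} :
      STr γ x X none → STr γ y Y none → STr γ (par x y) (X + Y) none
  | parSD {x y x' : APTCr E} {X Y : Multiset E} :
      STr γ x X (some x') → STr γ y Y none → STr γ (par x y) (X + Y) (some x')
  | parDS {x y y' : APTCr E} {X Y : Multiset E} :
      STr γ x X none → STr γ y Y (some y') → STr γ (par x y) (X + Y) (some y')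
  | parSS {x y x' y' : APTCr E} {X Y : Multiset E} :
      STr γ x X (some x') → STr γ y Y (some y') →
      STr γ (par x y) (X + Y) (some (merge x' y'))
  | commDD {x y : APTCr E} {e1 e2 c : E} :
      STr γ x {e1} none → STr γ y {e2} none → γ e1 e2 = some c →
      STr γ (comm x y) {c} none
  | commSD {x y x' : APTCr E} {e1 e2 c : E} :
      STr γ x {e1} (some x') → STr γ y {e2} none → γ e1 e2 = some c →
      STr γ (comm x y) {c} (some x')
  | commDS {x y y' : APTCr E} {e1 e2 c : E} :
      STr γ x {e1} none → STr γ y {e2} (some y') → γ e1 e2 = some c →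
      STr γ (comm x y) {c} (some y')
  | commSS {x y x' y' : APTCr E} {e1 e2 c : E} :
      STr γ x {e1} (some x') → STr γ y {e2} (some y') → γ e1 e2 = some c →
      STr γ (comm x y) {c} (some (merge x' y'))
  | mergePar {x y : APTCr E} {X : Multiset E} {o : Option (APTCr E)} :
      STr γ (par x y) X o → STr γ (merge x y) X o
  | mergeComm {x y : APTCr E} {X : Multiset E} {o : Option (APTCr E)} :
      STr γ (comm x y) X o → STr γ (merge x y) X o
  | recv {S : LinearSpec E} {i : Fin S.n} {X : Multiset E} {o : Option (APTCr E)} :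
      STr γ (rhsTerm S i) X o → STr γ (recvar S i) X o

/-- `R` is a step bisimulation. -/
def IsStepBisim (γ : E → E → Option E) (R : APTCr E → APTCr E → Prop) : Prop :=
  ∀ p q, R p q →
    (∀ X p', STr γ p X (some p') → ∃ q', STr γ q X (some q') ∧ R p' q') ∧
    (∀ X q', STr γ q X (some q') → ∃ p', STr γ p X (some p') ∧ R p' q') ∧
    (∀ X, STr γ p X none → STr γ q X none) ∧
    (∀ X, STr γ q X none → STr γ p X none)

/-- Step bisimilarity `p ∼s q`. -/
def StepBisim (γ : E → E → Option E) (p q : APTCr E) : Prop :=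
  ∃ R, IsStepBisim γ R ∧ R p q

end APTCr

namespace APTCr

variable {E : Type} {γ : E → E → Option E}

/-- Step bisimilarity is itself a step bisimulation. -/
theorem isStepBisim_stepBisim : IsStepBisim γ (StepBisim γ) := by
  rintro p q ⟨R, hR, hpq⟩
  obtain ⟨h1, h2, h3, h4⟩ := hR p q hpq
  refine ⟨fun X p' hp => ?_, fun X q' hq => ?_, h3, h4⟩
  · obtain ⟨q', hq, hr⟩ := h1 X p' hp
    exact ⟨q', hq, R, hR, hr⟩
  · obtain ⟨p', hp, hr⟩ := h2 X q' hq
    exact ⟨p', hp, R, hR, hr⟩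

theorem StepBisim.refl (p : APTCr E) : StepBisim γ p p := by
  refine ⟨Eq, ?_, rfl⟩
  rintro p _ rfl
  exact ⟨fun X p' h => ⟨p', h, rfl⟩, fun X p' h => ⟨p', h, rfl⟩, fun _ h => h, fun _ h => h⟩

theorem StepBisim.trans {p q r : APTCr E} (hpq : StepBisim γ p q) (hqr : StepBisim γ q r) :
    StepBisim γ p r := by
  refine ⟨fun a c => ∃ b, StepBisim γ a b ∧ StepBisim γ b c, ?_, q, hpq, hqr⟩
  rintro a c ⟨b, hab, hbc⟩
  obtain ⟨h1, h2, h3, h4⟩ := isStepBisim_stepBisim a b hab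
  obtain ⟨k1, k2, k3, k4⟩ := isStepBisim_stepBisim b c hbc
  refine ⟨fun X a' ha => ?_, fun X c' hc => ?_, fun X h => k3 X (h3 X h),
    fun X h => h4 X (k4 X h)⟩
  · obtain ⟨b', hb, hab'⟩ := h1 X a' ha
    obtain ⟨c', hc, hbc'⟩ := k1 X b' hb
    exact ⟨c', hc, b', hab', hbc'⟩
  · obtain ⟨b', hb, hbc'⟩ := k2 X c' hc
    obtain ⟨a', ha, hab'⟩ := h2 X b' hb
    exact ⟨a', ha, b', hab', hbc'⟩

/-- Two terms with the same transitions are step bisimilar. -/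
theorem StepBisim.of_forall_iff {p q : APTCr E} (h : ∀ X o, STr γ p X o ↔ STr γ q X o) :
    StepBisim γ p q := by
  refine ⟨fun a b => ∀ X o, STr γ a X o ↔ STr γ b X o, ?_, h⟩
  intro a b hab
  exact ⟨fun X a' ha => ⟨a', (hab _ _).1 ha, fun _ _ => Iff.rfl⟩,
    fun X b' hb => ⟨b', (hab _ _).2 hb, fun _ _ => Iff.rfl⟩,
    fun X => (hab X none).1, fun X => (hab X none).2⟩

theorem sTr_recvar_iff {S : LinearSpec E} {i : Fin S.n} {X : Multiset E}
    {o : Option (APTCr E)} : STr γ (recvar S i) X o ↔ STr γ (rhsTerm S i) X o :=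
  ⟨fun h => by cases h; assumption, STr.recv⟩

/-- A parallel composition of atomic events can only terminate successfully in one step. -/
theorem STr.eq_none_of_parOfList {l : E × List E} {X : Multiset E} {o : Option (APTCr E)}
    (h : STr γ (parOfList l) X o) : o = none := by
  have key : ∀ (as : List E) (t : APTCr E), (∀ X o, STr γ t X o → o = none) →
      ∀ X o, STr γ (as.foldl (fun t b => par t (atom b)) t) X o → o = none := by
    intro as
    induction as with
    | nil => exact fun t ht => ht
    | cons a as ih =>
      intro t ht
      refine ih _ fun X o h => ?_
      cases h with
      | parDD => rfl
      | parSD hx _ => cases ht _ _ hx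
      | parDS _ hy => cases hy
      | parSS hx _ => cases ht _ _ hx
  refine key l.2 (atom l.1) (fun X o h => ?_) X o h
  cases h
  rfl

theorem sTr_sumList_iff {l : List (APTCr E)} {X : Multiset E} {o : Option (APTCr E)} :
    STr γ (sumList l) X o ↔ ∃ t ∈ l, STr γ t X o := by
  induction l with
  | nil =>
    refine ⟨fun h => ?_, fun ⟨t, ht, _⟩ => by simp at ht⟩
    rw [sumList] at h
    cases h
  | cons t ts ih =>
    cases ts with
    | nil => simp [sumList]
    | cons u us =>
      have halt : STr γ (sumList (t :: u :: us)) X o ↔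
          STr γ t X o ∨ STr γ (sumList (u :: us)) X o := by
        refine ⟨fun h => ?_, fun h => h.elim (STr.altL _) (STr.altR _)⟩
        rw [sumList] at h
        · cases h with
          | altL _ h => exact Or.inl h
          | altR _ h => exact Or.inr h
        · simp
      simp [halt, ih]

/-- The transitions of a right-hand side `tᵢ(p 0, …, p (n-1))`: one of its summands is executed,
and the target is determined by the variable of that summand. -/
theorem sTr_rhsTermWith_iff {S : LinearSpec E} {p : Fin S.n → APTCr E} {i : Fin S.n}
    {X : Multiset E} {o : Option (APTCr E)} :
    STr γ (rhsTermWith S p i) X o ↔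
      ∃ s ∈ S.rhs i, STr γ (parOfList s.1) X none ∧ o = s.2.map p := by
  simp only [rhsTermWith, sTr_sumList_iff, List.mem_map, exists_exists_and_eq_and]
  refine exists_congr fun s => and_congr_right fun _ => ?_
  obtain ⟨l, _ | j⟩ := s
  · exact ⟨fun h => by cases h.eq_none_of_parOfList; exact ⟨h, rfl⟩, fun ⟨h, ho⟩ => ho ▸ h⟩
  · refine ⟨fun h => ?_, fun ⟨h, ho⟩ => ho ▸ STr.seqDone _ h⟩
    cases h with
    | seqDone _ h => exact ⟨h, rfl⟩
    | seqStep _ h => cases h.eq_none_of_parOfList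

/-- The transitions of a right-hand side do not depend on the terms substituted for its
variables. -/
theorem STr.exists_rhsTermWith {S : LinearSpec E} {p : Fin S.n → APTCr E} {i : Fin S.n}
    {X : Multiset E} {o : Option (APTCr E)} (h : STr γ (rhsTermWith S p i) X o) :
    ∃ v : Option (Fin S.n), o = v.map p ∧
      ∀ q : Fin S.n → APTCr E, STr γ (rhsTermWith S q i) X (v.map q) := by
  obtain ⟨s, hs, hX, ho⟩ := sTr_rhsTermWith_iff.1 h
  exact ⟨s.2, ho, fun q => sTr_rhsTermWith_iff.2 ⟨s, hs, hX, rfl⟩⟩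

/-- Any two solutions of a linear recursive specification are step bisimilar. -/
theorem stepBisim_of_solutions {S : LinearSpec E} {p q : Fin S.n → APTCr E}
    (hp : ∀ i, StepBisim γ (p i) (rhsTermWith S p i))
    (hq : ∀ i, StepBisim γ (q i) (rhsTermWith S q i)) (i : Fin S.n) :
    StepBisim γ (p i) (q i) := by
  refine ⟨fun a b => ∃ j, StepBisim γ a (p j) ∧ StepBisim γ b (q j), ?_,
    i, .refl _, .refl _⟩
  rintro a b ⟨j, ha, hb⟩
  obtain ⟨h1, h2, h3, h4⟩ := isStepBisim_stepBisim _ _ (ha.trans (hp j))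
  obtain ⟨k1, k2, k3, k4⟩ := isStepBisim_stepBisim _ _ (hb.trans (hq j))
  refine ⟨fun X a' h => ?_, fun X b' h => ?_, fun X h => ?_, fun X h => ?_⟩
  · obtain ⟨r, hr, har⟩ := h1 X a' h
    obtain ⟨_ | k, hv, hall⟩ := hr.exists_rhsTermWith
    · cases hv
    · cases hv
      obtain ⟨b', hb', hbr⟩ := k2 X _ (hall q)
      exact ⟨b', hb', k, har, hbr⟩
  · obtain ⟨r, hr, hbr⟩ := k1 X b' h
    obtain ⟨_ | k, hv, hall⟩ := hr.exists_rhsTermWith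
    · cases hv
    · cases hv
      obtain ⟨a', ha', har⟩ := h2 X _ (hall p)
      exact ⟨a', ha', k, har, hbr⟩
  · obtain ⟨_ | k, hv, hall⟩ := (h3 X h).exists_rhsTermWith
    · exact k4 X (hall q)
    · cases hv
  · obtain ⟨_ | k, hv, hall⟩ := (k3 X h).exists_rhsTermWith
    · exact h4 X (hall p)
    · cases hv

/-- A recursion constant is step bisimilar to its unfolding. -/
theorem stepBisim_recvar_rhsTerm (S : LinearSpec E) (i : Fin S.n) :
    StepBisim γ (recvar S i) (rhsTerm S i) :=
  .of_forall_iff fun _ _ => sTr_recvar_iff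

end APTCr


open APTCr in
/-- Soundness of RDP and RSP modulo step bisimulation, for a linear recursive
specification `S` with equations `Xᵢ = tᵢ(X₁, …, Xₙ)`:
(RDP) `⟨Xᵢ|S⟩ ∼s tᵢ(⟨X₁|S⟩, …, ⟨Xₙ|S⟩)` for every `i`; and
(RSP) if closed terms `p 1, …, p n` satisfy `p i ∼s tᵢ(p 1, …, p n)` for every `i`,
then `p i ∼s ⟨Xᵢ|S⟩` for every `i`. -/
theorem rdp_rsp_sound_step {E : Type} (γ : E → E → Option E) (S : LinearSpec E) :
    (∀ i : Fin S.n, StepBisim γ (recvar S i) (rhsTerm S i)) ∧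
    (∀ p : Fin S.n → APTCr E,
      (∀ i : Fin S.n, StepBisim γ (p i) (rhsTermWith S p i)) →
      ∀ i : Fin S.n, StepBisim γ (p i) (recvar S i)) :=
  ⟨stepBisim_recvar_rhsTerm S,
    fun _ hp => stepBisim_of_solutions hp (stepBisim_recvar_rhsTerm S)⟩
end

section
/- (Soundness of the Approximation Induction Principle modulo step bisimulation.) Let x and y be closed terms of APTC with linear recursion and projection operators. If πn(x) ∼s πn(y) for every n ∈ ℕ, then x ∼s y. -/
/-- Terms of the parallelism fragment of APTC extended with the recursion
constants `⟨Xᵢ|S⟩` for linear recursive specifications `S`. -/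
inductive APTCp (E : Type) : Type
  | atom : E → APTCp E
  | delta : APTCp E
  | seq : APTCp E → APTCp E → APTCp E
  | alt : APTCp E → APTCp E → APTCp E
  | par : APTCp E → APTCp E → APTCp E
  | comm : APTCp E → APTCp E → APTCp E
  | merge : APTCp E → APTCp E → APTCp E
  | recvar : (S : LinearSpec E) → Fin S.n → APTCp E
  | proj : ℕ → APTCp E → APTCp E

namespace APTCp

variable {E : Type}

/-- The term `a₁ ∥ ⋯ ∥ aₖ` for a nonempty list of atomic events. -/
def parOfList (p : E × List E) : APTCp E :=
  p.2.foldl (fun t b => par t (atom b)) (atom p.1)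

/-- Finite sum of a list of terms; the empty sum denotes the deadlock δ. -/
def sumList : List (APTCp E) → APTCp E
  | [] => delta
  | [t] => t
  | t :: ts => alt t (sumList ts)

/-- The right-hand side `tᵢ(p 0, …, p (n-1))` of the `i`-th equation of `S`, with the
recursion variables instantiated by the terms `p j`. -/
def rhsTermWith (S : LinearSpec E) (p : Fin S.n → APTCp E) (i : Fin S.n) : APTCp E :=
  sumList ((S.rhs i).map fun s =>
    match s.2 with
    | none => parOfList s.1
    | some j => seq (parOfList s.1) (p j))

/-- The term `tᵢ(⟨X₁|S⟩, …, ⟨Xₙ|S⟩)`. -/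
def rhsTerm (S : LinearSpec E) (i : Fin S.n) : APTCp E :=
  rhsTermWith S (recvar S) i

/-- Step transitions `t →X t'` (target `some t'`) and `t →X √` (target `none`),
labelled by nonempty finite multisets `X` over `E`; `γ` is the communication function. -/
inductive STr (γ : E → E → Option E) : APTCp E → Multiset E → Option (APTCp E) → Prop
  | ax (e : E) : STr γ (atom e) {e} none
  | altL {x : APTCp E} {X : Multiset E} {o : Option (APTCp E)} (y : APTCp E) :
      STr γ x X o → STr γ (alt x y) X o
  | altR (x : APTCp E) {y : APTCp E} {X : Multiset E} {o : Option (APTCp E)} :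
      STr γ y X o → STr γ (alt x y) X o
  | seqDone {x : APTCp E} {X : Multiset E} (y : APTCp E) :
      STr γ x X none → STr γ (seq x y) X (some y)
  | seqStep {x x' : APTCp E} {X : Multiset E} (y : APTCp E) :
      STr γ x X (some x') → STr γ (seq x y) X (some (seq x' y))
  | parDD {x y : APTCp E} {X Y : Multiset E} :
      STr γ x X none → STr γ y Y none → STr γ (par x y) (X + Y) none
  | parSD {x y x' : APTCp E} {X Y : Multiset E} :
      STr γ x X (some x') → STr γ y Y none → STr γ (par x y) (X + Y) (some x')
  | parDS {x y y' : APTCp E} {X Y : Multiset E} :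
      STr γ x X none → STr γ y Y (some y') → STr γ (par x y) (X + Y) (some y')
  | parSS {x y x' y' : APTCp E} {X Y : Multiset E} :
      STr γ x X (some x') → STr γ y Y (some y') →
      STr γ (par x y) (X + Y) (some (merge x' y'))
  | commDD {x y : APTCp E} {e1 e2 c : E} :
      STr γ x {e1} none → STr γ y {e2} none → γ e1 e2 = some c →
      STr γ (comm x y) {c} none
  | commSD {x y x' : APTCp E} {e1 e2 c : E} :
      STr γ x {e1} (some x') → STr γ y {e2} none → γ e1 e2 = some c →
      STr γ (comm x y) {c} (some x')
  | commDS {x y y' : APTCp E} {e1 e2 c : E} :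
      STr γ x {e1} none → STr γ y {e2} (some y') → γ e1 e2 = some c →
      STr γ (comm x y) {c} (some y')
  | commSS {x y x' y' : APTCp E} {e1 e2 c : E} :
      STr γ x {e1} (some x') → STr γ y {e2} (some y') → γ e1 e2 = some c →
      STr γ (comm x y) {c} (some (merge x' y'))
  | mergePar {x y : APTCp E} {X : Multiset E} {o : Option (APTCp E)} :
      STr γ (par x y) X o → STr γ (merge x y) X o
  | mergeComm {x y : APTCp E} {X : Multiset E} {o : Option (APTCp E)} :
      STr γ (comm x y) X o → STr γ (merge x y) X o
  | recv {S : LinearSpec E} {i : Fin S.n} {X : Multiset E} {o : Option (APTCp E)} :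
      STr γ (rhsTerm S i) X o → STr γ (recvar S i) X o
  | projDone {x : APTCp E} {X : Multiset E} (n : ℕ) :
      STr γ x X none → STr γ (proj (n + 1) x) X none
  | projStep {x x' : APTCp E} {X : Multiset E} (n : ℕ) :
      STr γ x X (some x') → STr γ (proj (n + 1) x) X (some (proj n x'))

/-- `R` is a step bisimulation. -/
def IsStepBisim (γ : E → E → Option E) (R : APTCp E → APTCp E → Prop) : Prop :=
  ∀ p q, R p q →
    (∀ X p', STr γ p X (some p') → ∃ q', STr γ q X (some q') ∧ R p' q') ∧
    (∀ X q', STr γ q X (some q') → ∃ p', STr γ p X (some p') ∧ R p' q') ∧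
    (∀ X, STr γ p X none → STr γ q X none) ∧
    (∀ X, STr γ q X none → STr γ p X none)

/-- Step bisimilarity `p ∼s q`. -/
def StepBisim (γ : E → E → Option E) (p q : APTCp E) : Prop :=
  ∃ R, IsStepBisim γ R ∧ R p q

end APTCp

namespace APTCp

variable {E : Type} {γ : E → E → Option E}

/-- The set of all transitions of a term. -/
def transitions (γ : E → E → Option E) (p : APTCp E) : Set (Multiset E × Option (APTCp E)) :=
  {t | STr γ p t.1 t.2}

/-- The target of a joint step of two parallel components. -/
def joinTarget : Option (APTCp E) → Option (APTCp E) → Option (APTCp E)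
  | none, none => none
  | some x, none => some x
  | none, some y => some y
  | some x, some y => some (merge x y)

theorem finite_transitions_atom (e : E) : (transitions γ (atom e)).Finite := by
  refine (Set.finite_singleton (({e}, none) : Multiset E × Option (APTCp E))).subset ?_
  rintro ⟨X, o⟩ (h : STr γ _ X o)
  cases h
  rfl

theorem finite_transitions_delta : (transitions γ (delta : APTCp E)).Finite := by
  refine Set.finite_empty.subset ?_
  rintro ⟨X, o⟩ (h : STr γ _ X o)
  cases h

theorem finite_transitions_seq {x : APTCp E} (hx : (transitions γ x).Finite) (y : APTCp E) :
    (transitions γ (seq x y)).Finite := by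
  refine (hx.image fun t => (t.1, some (t.2.elim y fun x' => seq x' y))).subset ?_
  rintro ⟨X, o⟩ (h : STr γ _ X o)
  cases h with
  | seqDone _ h => exact ⟨(X, none), h, rfl⟩
  | seqStep _ h => exact ⟨(X, some _), h, rfl⟩

theorem finite_transitions_alt {x y : APTCp E} (hx : (transitions γ x).Finite)
    (hy : (transitions γ y).Finite) : (transitions γ (alt x y)).Finite := by
  refine (hx.union hy).subset ?_
  rintro ⟨X, o⟩ (h : STr γ _ X o)
  cases h with
  | altL _ h => exact Or.inl h
  | altR _ h => exact Or.inr h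

theorem finite_transitions_par {x y : APTCp E} (hx : (transitions γ x).Finite)
    (hy : (transitions γ y).Finite) : (transitions γ (par x y)).Finite := by
  refine (hx.image2 (fun s t => (s.1 + t.1, joinTarget s.2 t.2)) hy).subset ?_
  rintro ⟨X, o⟩ (h : STr γ _ X o)
  cases h with
  | parDD h₁ h₂ => exact ⟨(_, none), h₁, (_, none), h₂, rfl⟩
  | parSD h₁ h₂ => exact ⟨(_, some _), h₁, (_, none), h₂, rfl⟩
  | parDS h₁ h₂ => exact ⟨(_, none), h₁, (_, some _), h₂, rfl⟩
  | parSS h₁ h₂ => exact ⟨(_, some _), h₁, (_, some _), h₂, rfl⟩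

theorem finite_transitions_comm {x y : APTCp E} (hx : (transitions γ x).Finite)
    (hy : (transitions γ y).Finite) : (transitions γ (comm x y)).Finite := by
  let joint (s t : Multiset E × Option (APTCp E)) : Set (Multiset E × Option (APTCp E)) :=
    {u | ∃ e₁ e₂ c, s.1 = {e₁} ∧ t.1 = {e₂} ∧ γ e₁ e₂ = some c ∧ u = ({c}, joinTarget s.2 t.2)}
  have joint_finite (s t) : (joint s t).Finite := by
    refine Set.Subsingleton.finite ?_
    rintro _ ⟨e₁, e₂, c, hs, ht, hc, rfl⟩ _ ⟨e₁', e₂', c', hs', ht', hc', rfl⟩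
    obtain rfl : e₁ = e₁' := Multiset.singleton_inj.1 (hs.symm.trans hs')
    obtain rfl : e₂ = e₂' := Multiset.singleton_inj.1 (ht.symm.trans ht')
    obtain rfl : c = c' := Option.some.inj (hc.symm.trans hc')
    rfl
  refine (hx.biUnion fun s _ => hy.biUnion fun t _ => joint_finite s t).subset ?_
  rintro ⟨X, o⟩ (h : STr γ _ X o)
  simp only [Set.mem_iUnion]
  cases h with
  | commDD h₁ h₂ hc => exact ⟨(_, none), h₁, (_, none), h₂, _, _, _, rfl, rfl, hc, rfl⟩
  | commSD h₁ h₂ hc => exact ⟨(_, some _), h₁, (_, none), h₂, _, _, _, rfl, rfl, hc, rfl⟩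
  | commDS h₁ h₂ hc => exact ⟨(_, none), h₁, (_, some _), h₂, _, _, _, rfl, rfl, hc, rfl⟩
  | commSS h₁ h₂ hc => exact ⟨(_, some _), h₁, (_, some _), h₂, _, _, _, rfl, rfl, hc, rfl⟩

theorem finite_transitions_merge {x y : APTCp E} (hx : (transitions γ x).Finite)
    (hy : (transitions γ y).Finite) : (transitions γ (merge x y)).Finite := by
  refine ((finite_transitions_par hx hy).union (finite_transitions_comm hx hy)).subset ?_
  rintro ⟨X, o⟩ (h : STr γ _ X o)
  cases h with
  | mergePar h => exact Or.inl h
  | mergeComm h => exact Or.inr h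

theorem finite_transitions_proj {x : APTCp E} (hx : (transitions γ x).Finite) (n : ℕ) :
    (transitions γ (proj n x)).Finite := by
  refine (hx.image fun t => (t.1, t.2.map (proj (n - 1)))).subset ?_
  rintro ⟨X, o⟩ (h : STr γ _ X o)
  cases h with
  | projDone _ h => exact ⟨(X, none), h, rfl⟩
  | projStep _ h => exact ⟨(X, some _), h, rfl⟩

theorem finite_transitions_parOfList (p : E × List E) : (transitions γ (parOfList p)).Finite := by
  obtain ⟨a, l⟩ := p
  have foldl_finite (t : APTCp E) (ht : (transitions γ t).Finite) :
      (transitions γ (l.foldl (fun t b => par t (atom b)) t)).Finite := by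
    induction l generalizing t with
    | nil => exact ht
    | cons b l ih => exact ih _ (finite_transitions_par ht (finite_transitions_atom b))
  exact foldl_finite _ (finite_transitions_atom a)

theorem finite_transitions_sumList (l : List (APTCp E)) (hl : ∀ t ∈ l, (transitions γ t).Finite) :
    (transitions γ (sumList l)).Finite := by
  induction l with
  | nil => exact finite_transitions_delta
  | cons t l ih =>
    rw [List.forall_mem_cons] at hl
    cases l with
    | nil => exact hl.1
    | cons u l => exact finite_transitions_alt hl.1 (ih hl.2)

theorem finite_transitions_recvar (S : LinearSpec E) (i : Fin S.n) :
    (transitions γ (recvar S i)).Finite := by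
  have rhs_finite : (transitions γ (rhsTerm S i)).Finite := by
    refine finite_transitions_sumList _ fun t ht => ?_
    obtain ⟨⟨p, o⟩, -, rfl⟩ := List.mem_map.1 ht
    cases o with
    | none => exact finite_transitions_parOfList p
    | some j => exact finite_transitions_seq (finite_transitions_parOfList p) _
  refine rhs_finite.subset ?_
  rintro ⟨X, o⟩ (h : STr γ _ X o)
  cases h with
  | recv h => exact h

/-- The step transition system of the calculus is finitely branching. -/
theorem finite_transitions (p : APTCp E) : (transitions γ p).Finite := by
  induction p with
  | atom e => exact finite_transitions_atom e
  | delta => exact finite_transitions_delta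
  | seq x y hx _ => exact finite_transitions_seq hx y
  | alt x y hx hy => exact finite_transitions_alt hx hy
  | par x y hx hy => exact finite_transitions_par hx hy
  | comm x y hx hy => exact finite_transitions_comm hx hy
  | merge x y hx hy => exact finite_transitions_merge hx hy
  | recvar S i => exact finite_transitions_recvar S i
  | proj n x hx => exact finite_transitions_proj hx n

theorem finite_successors (p : APTCp E) (X : Multiset E) : {p' | STr γ p X (some p')}.Finite := by
  refine Set.Finite.preimage (f := fun p' => (X, some p')) ?_ (finite_transitions (γ := γ) p)
  intro _ _ _ _ h
  simpa using h

theorem StepBisim.symm {p q : APTCp E} (h : StepBisim γ p q) : StepBisim γ q p := by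
  obtain ⟨R, hR, hpq⟩ := h
  refine ⟨fun a b => R b a, fun a b hab => ?_, hpq⟩
  obtain ⟨h₁, h₂, h₃, h₄⟩ := hR b a hab
  exact ⟨h₂, h₁, h₄, h₃⟩

/-- A symmetric relation is a step bisimulation if it is a step simulation. -/
theorem IsStepBisim.of_symmetric {R : APTCp E → APTCp E → Prop} (symm : ∀ p q, R p q → R q p)
    (step : ∀ p q, R p q → ∀ X p', STr γ p X (some p') → ∃ q', STr γ q X (some q') ∧ R p' q')
    (done : ∀ p q, R p q → ∀ X, STr γ p X none → STr γ q X none) : IsStepBisim γ R := by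
  refine fun p q h => ⟨step p q h, fun X q' hq => ?_, done p q h, done q p (symm p q h)⟩
  obtain ⟨p', hp, h'⟩ := step q p (symm p q h) X q' hq
  exact ⟨p', hp, symm _ _ h'⟩

theorem StepBisim.exists_step_of_proj_succ {n : ℕ} {p q p' : APTCp E} {X : Multiset E}
    (h : StepBisim γ (proj (n + 1) p) (proj (n + 1) q)) (hp : STr γ p X (some p')) :
    ∃ q', STr γ q X (some q') ∧ StepBisim γ (proj n p') (proj n q') := by
  obtain ⟨R, hR, hpq⟩ := h
  obtain ⟨r, hr, hr'⟩ := (hR _ _ hpq).1 X _ (.projStep n hp)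
  cases hr with
  | projStep _ hq => exact ⟨_, hq, R, hR, hr'⟩

theorem StepBisim.done_of_proj_succ {n : ℕ} {p q : APTCp E} {X : Multiset E}
    (h : StepBisim γ (proj (n + 1) p) (proj (n + 1) q)) (hp : STr γ p X none) :
    STr γ q X none := by
  obtain ⟨R, hR, hpq⟩ := h
  cases (hR _ _ hpq).2.2.1 X (.projDone n hp) with
  | projDone _ hq => exact hq

theorem StepBisim.proj_of_le {m n : ℕ} (hmn : m ≤ n) {p q : APTCp E}
    (h : StepBisim γ (proj n p) (proj n q)) : StepBisim γ (proj m p) (proj m q) := by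
  refine ⟨fun a b => ∃ m n p q, m ≤ n ∧ a = proj m p ∧ b = proj m q ∧
    StepBisim γ (proj n p) (proj n q), .of_symmetric ?_ ?_ ?_, m, n, p, q, hmn, rfl, rfl, h⟩
  · rintro _ _ ⟨m, n, p, q, hmn, rfl, rfl, h⟩
    exact ⟨m, n, q, p, hmn, rfl, rfl, h.symm⟩
  · rintro _ _ ⟨_, n, p, q, hmn, rfl, rfl, h⟩ X _ (_ | _)
    rename_i p' m hp
    obtain ⟨n, rfl⟩ := Nat.exists_eq_succ_of_ne_zero (Nat.ne_zero_of_lt hmn)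
    obtain ⟨q', hq, h'⟩ := h.exists_step_of_proj_succ hp
    exact ⟨_, .projStep m hq, m, n, p', q', Nat.le_of_succ_le_succ hmn, rfl, rfl, h'⟩
  · rintro _ _ ⟨_, n, p, q, hmn, rfl, rfl, h⟩ X (_ | _)
    rename_i m hp
    obtain ⟨n, rfl⟩ := Nat.exists_eq_succ_of_ne_zero (Nat.ne_zero_of_lt hmn)
    exact .projDone m (h.done_of_proj_succ hp)

/-- Agreement of all projections is a step bisimulation. -/
theorem isStepBisim_forall_proj :
    IsStepBisim γ fun p q => ∀ n, StepBisim γ (proj n p) (proj n q) := by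
  refine .of_symmetric (fun p q h n => (h n).symm) (fun p q h X p' hp => ?_)
    fun p q h X hp => (h 1).done_of_proj_succ hp
  choose f hf hbisim using fun n => (h (n + 1)).exists_step_of_proj_succ hp
  obtain ⟨q', hq, hinf⟩ : ∃ q' ∈ {q' | STr γ q X (some q')}, (f ⁻¹' {q'}).Infinite := by
    by_contra! hfin
    refine Set.infinite_univ (α := ℕ) (((finite_successors q X).biUnion hfin).subset ?_)
    intro n _
    simpa using hf n
  refine ⟨q', hq, fun n => ?_⟩
  obtain ⟨m, rfl, hnm⟩ := hinf.exists_gt n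
  exact (hbisim m).proj_of_le hnm.le

end APTCp

open APTCp in
/-- Soundness of the Approximation Induction Principle (AIP) modulo step
bisimulation: for closed terms `x`, `y` of APTC with linear recursion and
projection operators, if `πₙ(x) ∼s πₙ(y)` for every `n ∈ ℕ`, then `x ∼s y`. -/
theorem aip_sound_step {E : Type} (γ : E → E → Option E) (x y : APTCp E)
    (h : ∀ n : ℕ, StepBisim γ (proj n x) (proj n y)) :
    StepBisim γ x y :=
  ⟨_, isStepBisim_forall_proj, h⟩
end
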